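/- (Polynomial Gauss identity) For every nonnegative integer L, ∑_{l=0}^{L} q^{T_l} = ∑_{i,j,k≥0} q^{T_i+T_j+T_k} (-1)^k [L-i choose j]_q [L-j choose k]_q [L-k choose i]_q, where T_n = n(n+1)/2. -/

import Mathlib

/-- The q-Pochhammer symbol `(a;q)_n = ∏_{m=0}^{n-1} (1 - a q^m)`. -/
noncomputable def qPoch {K : Type*} [Field K] (a q : K) (n : ℕ) : K :=
  ∏ m ∈ Finset.range n, (1 - a * q ^ m)

/-- The Gaussian binomial coefficient `[m choose n]_q`, interpreted as `0`
when `n < 0` or `m < n`. -/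
noncomputable def qbinom {K : Type*} [Field K] (q : K) (m n : ℤ) : K :=
  if 0 ≤ n ∧ n ≤ m then
    qPoch q q m.toNat / (qPoch q q n.toNat * qPoch q q (m - n).toNat)
  else 0

/-- Triangular numbers `T n = n(n+1)/2`. -/
def T (n : ℕ) : ℕ := n * (n + 1) / 2

/-- The Gaussian binomial coefficient with natural number arguments. -/
noncomputable def gaussBinom {K : Type*} [Field K] (q : K) (n k : ℕ) : K :=
  if k ≤ n then qPoch q q n / (qPoch q q k * qPoch q q (n - k)) else 0

/-- The alternating sum `∑ₖ (-1)^k q^{T k} [N choose k] [m - k choose i]`, for `N ≤ m`. -/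
noncomputable def altSum {K : Type*} [Field K] (q : K) (N m i : ℕ) : K :=
  ∑ k ∈ Finset.range (N + 1),
    (-1) ^ k * q ^ T k * gaussBinom q N k * gaussBinom q (m - k) i

/-- The summand of the double sum left after summing over `k`. -/
noncomputable def doubleTerm {K : Type*} [Field K] (q : K) (L i j : ℕ) : K :=
  q ^ (T i + T j) * (qPoch q q (L - i) * qPoch q q (L - j)) /
    (qPoch q q i * qPoch q q j * qPoch q q (L - i - j))

/-- The antisymmetric part of the difference of `doubleTerm q (M + 1)` and `doubleTerm q M`. -/
noncomputable def antisymmTerm {K : Type*} [Field K] (q : K) (M i j : ℕ) : K :=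
  (q ^ i - q ^ j) * q ^ (M + 1 - i - j) * doubleTerm q M i j

/-- The antidifference in `i` of the rest of that difference. -/
noncomputable def antidiff {K : Type*} [Field K] (q : K) (M j : ℕ) : ℕ → K
  | 0 => 0
  | i + 1 => -(q ^ (M - i - j) * q ^ (T (i + 1) + T j) * (qPoch q q (M - i) * qPoch q q (M - j)) /
      (qPoch q q i * qPoch q q j * qPoch q q (M - i - j)))

lemma T_succ (n : ℕ) : T (n + 1) = T n + (n + 1) := by
  unfold T
  rw [show (n + 1) * (n + 1 + 1) = n * (n + 1) + (n + 1) * 2 by ring,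
    Nat.add_mul_div_right _ _ two_pos]

section

variable {K : Type*} [Field K] {q : K} {L : ℕ}

lemma qPoch_zero (q : K) : qPoch q q 0 = 1 := by simp [qPoch]

lemma qPoch_succ (q : K) (n : ℕ) : qPoch q q (n + 1) = qPoch q q n * (1 - q ^ (n + 1)) := by
  rw [qPoch, Finset.prod_range_succ, ← qPoch, pow_succ']

lemma qPoch_ne_zero (hq : ∀ n : ℕ, 1 ≤ n → n ≤ L → q ^ n ≠ 1) {n : ℕ} (hn : n ≤ L) :
    qPoch q q n ≠ 0 := by
  refine Finset.prod_ne_zero_iff.mpr fun m hm h => ?_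
  rw [Finset.mem_range] at hm
  refine hq (m + 1) (by omega) (by omega) ?_
  rw [pow_succ']
  exact (sub_eq_zero.mp h).symm

lemma one_sub_pow_ne_zero (hq : ∀ n : ℕ, 1 ≤ n → n ≤ L → q ^ n ≠ 1) {n : ℕ} (hn : n + 1 ≤ L) :
    1 - q ^ (n + 1) ≠ 0 :=
  fun h => hq (n + 1) (by omega) hn (sub_eq_zero.mp h).symm

lemma gaussBinom_add (q : K) (s k : ℕ) :
    gaussBinom q (k + s) k = qPoch q q (k + s) / (qPoch q q k * qPoch q q s) := by
  simp [gaussBinom]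

lemma gaussBinom_of_lt (q : K) {n k : ℕ} (h : n < k) : gaussBinom q n k = 0 := by
  simp [gaussBinom, h]

lemma gaussBinom_self (hq : ∀ n : ℕ, 1 ≤ n → n ≤ L → q ^ n ≠ 1) {n : ℕ} (hn : n ≤ L) :
    gaussBinom q n n = 1 := by
  have := qPoch_ne_zero hq hn
  simp [gaussBinom, qPoch_zero, this]

lemma gaussBinom_zero (hq : ∀ n : ℕ, 1 ≤ n → n ≤ L → q ^ n ≠ 1) {n : ℕ} (hn : n ≤ L) :
    gaussBinom q n 0 = 1 := by
  have := qPoch_ne_zero hq hn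
  simp [gaussBinom, qPoch_zero, this]

lemma gaussBinom_succ_succ (hq : ∀ n : ℕ, 1 ≤ n → n ≤ L → q ^ n ≠ 1) {n k : ℕ}
    (hn : n + 1 ≤ L) :
    gaussBinom q (n + 1) (k + 1) = gaussBinom q n k + q ^ (k + 1) * gaussBinom q n (k + 1) := by
  rcases lt_trichotomy n k with h | rfl | h
  · simp [gaussBinom_of_lt q h, gaussBinom_of_lt q (Nat.lt_succ_of_lt h),
      gaussBinom_of_lt q (Nat.succ_lt_succ h)]
  · rw [gaussBinom_self hq hn, gaussBinom_self hq (by omega),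
      gaussBinom_of_lt q (Nat.lt_succ_self n)]
    simp
  · obtain ⟨s, rfl⟩ := Nat.exists_eq_add_of_lt h
    have h1 := qPoch_ne_zero hq (n := k) (by omega)
    have h2 := qPoch_ne_zero hq (n := s) (by omega)
    have h3 := one_sub_pow_ne_zero hq (n := k) (by omega)
    have h4 := one_sub_pow_ne_zero hq (n := s) (by omega)
    rw [show k + s + 1 + 1 = k + 1 + (s + 1) by ring, gaussBinom_add,
      show k + s + 1 = k + 1 + s by ring, gaussBinom_add,
      show k + 1 + s = k + (s + 1) by ring, gaussBinom_add,
      show k + 1 + (s + 1) = k + (s + 1) + 1 by ring]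
    simp only [qPoch_succ]
    field_simp
    ring

lemma gaussBinom_succ_succ' (hq : ∀ n : ℕ, 1 ≤ n → n ≤ L → q ^ n ≠ 1) {n k : ℕ}
    (hn : n + 1 ≤ L) (hk : k ≤ n) :
    gaussBinom q (n + 1) (k + 1) = gaussBinom q n (k + 1) + q ^ (n - k) * gaussBinom q n k := by
  rcases hk.eq_or_lt with rfl | h
  · rw [gaussBinom_self hq hn, gaussBinom_self hq (by omega),
      gaussBinom_of_lt q (Nat.lt_succ_self k)]
    simp
  · obtain ⟨s, rfl⟩ := Nat.exists_eq_add_of_lt h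
    have h1 := qPoch_ne_zero hq (n := k) (by omega)
    have h2 := qPoch_ne_zero hq (n := s) (by omega)
    have h3 := one_sub_pow_ne_zero hq (n := k) (by omega)
    have h4 := one_sub_pow_ne_zero hq (n := s) (by omega)
    rw [show k + s + 1 - k = s + 1 by omega,
      show k + s + 1 + 1 = k + 1 + (s + 1) by ring, gaussBinom_add,
      show k + s + 1 = k + 1 + s by ring, gaussBinom_add,
      show k + 1 + s = k + (s + 1) by ring, gaussBinom_add,
      show k + 1 + (s + 1) = k + (s + 1) + 1 by ring]
    simp only [qPoch_succ]
    field_simp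
    ring

lemma altSum_succ_left (hq : ∀ n : ℕ, 1 ≤ n → n ≤ L → q ^ n ≠ 1) {N m : ℕ} (i : ℕ)
    (hN : N + 1 ≤ L) :
    altSum q (N + 1) (m + 1) i = altSum q N (m + 1) i - q ^ (N + 1) * altSum q N m i := by
  have key : ∀ k ∈ Finset.range (N + 1),
      (-1) ^ (k + 1) * q ^ T (k + 1) * gaussBinom q (N + 1) (k + 1) *
          gaussBinom q (m + 1 - (k + 1)) i =
        (-1) ^ (k + 1) * q ^ T (k + 1) * gaussBinom q N (k + 1) *
            gaussBinom q (m + 1 - (k + 1)) i -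
          q ^ (N + 1) * ((-1) ^ k * q ^ T k * gaussBinom q N k * gaussBinom q (m - k) i) := by
    intro k hk
    obtain ⟨s, rfl⟩ := Nat.exists_eq_add_of_le (Nat.lt_succ_iff.mp (Finset.mem_range.mp hk))
    rw [gaussBinom_succ_succ' hq hN (Nat.le_add_right k s), Nat.add_sub_cancel_left,
      Nat.add_sub_add_right, T_succ]
    ring
  have hz : altSum q N (m + 1) i = ∑ k ∈ Finset.range (N + 1 + 1),
      (-1) ^ k * q ^ T k * gaussBinom q N k * gaussBinom q (m + 1 - k) i := by
    rw [Finset.sum_range_succ, gaussBinom_of_lt q (Nat.lt_succ_self N)]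
    simp [altSum]
  rw [hz, altSum, altSum, Finset.sum_range_succ', Finset.sum_range_succ' _ (N + 1),
    Finset.sum_congr rfl key, Finset.sum_sub_distrib, ← Finset.mul_sum,
    gaussBinom_zero hq hN, gaussBinom_zero hq (n := N) (by omega)]
  ring

lemma altSum_succ_right (hq : ∀ n : ℕ, 1 ≤ n → n ≤ L → q ^ n ≠ 1) {N m : ℕ} (i : ℕ)
    (hm : m + 1 ≤ L) (hN : N ≤ m) :
    altSum q N (m + 1) (i + 1) = altSum q N m i + q ^ (i + 1) * altSum q N m (i + 1) := by
  unfold altSum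
  rw [Finset.mul_sum, ← Finset.sum_add_distrib]
  refine Finset.sum_congr rfl fun k hk => ?_
  rw [Finset.mem_range] at hk
  rw [show m + 1 - k = m - k + 1 by omega, gaussBinom_succ_succ hq (by omega)]
  ring

lemma altSum_self (hq : ∀ n : ℕ, 1 ≤ n → n ≤ L → q ^ n ≠ 1) (i m : ℕ) (hm : m ≤ L)
    (hi : i ≤ m) : altSum q i m i = 1 := by
  induction i generalizing m with
  | zero => simp [altSum, T, gaussBinom_zero hq hm, gaussBinom_zero hq (Nat.zero_le L)]
  | succ i ih =>
    obtain ⟨m, rfl⟩ : ∃ m', m = m' + 1 := ⟨m - 1, by omega⟩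
    rw [altSum_succ_left hq _ (by omega), altSum_succ_right hq _ hm (by omega),
      ih m (by omega) (by omega)]
    ring

lemma altSum_eq (hq : ∀ n : ℕ, 1 ≤ n → n ≤ L → q ^ n ≠ 1) {N m i : ℕ} (hm : m ≤ L)
    (hN : N ≤ m) (hi : i ≤ N) : altSum q N m i = qPoch q q N / qPoch q q i := by
  induction N, hi using Nat.le_induction generalizing m with
  | base => rw [altSum_self hq i m hm hN, div_self (qPoch_ne_zero hq (by omega))]
  | succ N hi ih =>
    obtain ⟨m, rfl⟩ : ∃ m', m = m' + 1 := ⟨m - 1, by omega⟩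
    rw [altSum_succ_left hq _ (by omega), ih hm (by omega), ih (by omega) (by omega), qPoch_succ]
    ring

lemma doubleTerm_comm (q : K) (L i j : ℕ) : doubleTerm q L i j = doubleTerm q L j i := by
  rw [doubleTerm, doubleTerm, Nat.sub_right_comm, add_comm, mul_comm (qPoch q q (L - i)),
    mul_comm (qPoch q q i)]

lemma doubleTerm_sub (hq : ∀ n : ℕ, 1 ≤ n → n ≤ L → q ^ n ≠ 1) {M i j : ℕ} (hM : M + 1 ≤ L)
    (hij : i + j ≤ M) :
    doubleTerm q (M + 1) i j - doubleTerm q M i j - antisymmTerm q M i j =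
      antidiff q M j (i + 1) - antidiff q M j i := by
  obtain ⟨s, rfl⟩ := Nat.exists_eq_add_of_le hij
  have h1 := qPoch_ne_zero hq (n := i) (by omega)
  have h2 := qPoch_ne_zero hq (n := s) (by omega)
  have h3 := qPoch_ne_zero hq (n := j) (by omega)
  have h4 := one_sub_pow_ne_zero hq (n := s) (by omega)
  cases i with
  | zero =>
    simp only [antidiff, antisymmTerm, doubleTerm, T_succ,
      show 0 + j + s + 1 - 0 = j + s + 1 by omega, show 0 + j + s + 1 - j = s + 1 by omega,
      show j + s + 1 - j = s + 1 by omega, show 0 + j + s - 0 = j + s by omega,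
      show 0 + j + s - j = s by omega, show j + s - j = s by omega, qPoch_succ]
    field_simp
    ring
  | succ i =>
    have h5 := one_sub_pow_ne_zero hq (n := i) (by omega)
    have h6 := qPoch_ne_zero hq (n := i) (by omega)
    simp only [antidiff, antisymmTerm, doubleTerm, T_succ,
      show i + 1 + j + s + 1 - (i + 1) = j + s + 1 by omega,
      show i + 1 + j + s + 1 - j = i + s + 1 + 1 by omega,
      show j + s + 1 - j = s + 1 by omega,
      show i + 1 + j + s - (i + 1) = j + s by omega,
      show i + 1 + j + s - j = i + s + 1 by omega,
      show i + 1 + j + s - i = j + s + 1 by omega,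
      show j + s - j = s by omega, qPoch_succ]
    field_simp
    ring

lemma sum_doubleTerm_succ (hq : ∀ n : ℕ, 1 ≤ n → n ≤ L → q ^ n ≠ 1) {M j : ℕ}
    (hM : M + 1 ≤ L) (hj : j ≤ M) :
    ∑ i ∈ Finset.range (M + 1 + 1 - j), doubleTerm q (M + 1) i j =
      ∑ i ∈ Finset.range (M + 1 - j), (doubleTerm q M i j + antisymmTerm q M i j) := by
  obtain ⟨N, rfl⟩ := Nat.exists_eq_add_of_le hj
  have tele := Finset.sum_range_sub (antidiff q (j + N) j) (N + 1)
  rw [← Finset.sum_congr rfl fun i hi => doubleTerm_sub hq (i := i) (j := j) hM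
      (by rw [Finset.mem_range] at hi; omega)] at tele
  simp only [sub_sub, Finset.sum_sub_distrib] at tele
  have h1 := qPoch_ne_zero hq (n := N) (by omega)
  have h2 := qPoch_ne_zero hq (n := N + 1) (by omega)
  have h3 := qPoch_ne_zero hq (n := j) (by omega)
  have last : doubleTerm q (j + N + 1) (N + 1) j = -antidiff q (j + N) j (N + 1) := by
    simp only [antidiff, doubleTerm, show j + N + 1 - (N + 1) = j by omega,
      show j + N + 1 - j = N + 1 by omega, show j + N - N = j by omega,
      show j + N - j = N by omega, Nat.sub_self, qPoch_zero]
    field_simp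
  rw [show j + N + 1 + 1 - j = N + 1 + 1 by omega, show j + N + 1 - j = N + 1 by omega,
    Finset.sum_range_succ, last]
  have h0 : antidiff q (j + N) j 0 = 0 := rfl
  rw [h0] at tele
  linear_combination tele

lemma sum_antisymmTerm (q : K) (M : ℕ) :
    ∑ j ∈ Finset.range (M + 1), ∑ i ∈ Finset.range (M + 1 - j), antisymmTerm q M i j = 0 := by
  rw [Finset.sum_sigma']
  refine Finset.sum_involution (fun x _ => ⟨x.2, x.1⟩) ?_ ?_ ?_ ?_
  · rintro ⟨j, i⟩ -
    simp only [antisymmTerm]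
    rw [doubleTerm_comm q M j i, Nat.sub_right_comm (M + 1) j i]
    ring
  · rintro ⟨j, i⟩ - h h'
    simp only [Sigma.mk.injEq, heq_eq_eq] at h'
    exact h (by simp [antisymmTerm, h'.1])
  · rintro ⟨j, i⟩ h
    simp only [Finset.mem_sigma, Finset.mem_range] at h ⊢
    omega
  · rintro ⟨j, i⟩ -
    rfl

lemma sum_sum_doubleTerm (hq : ∀ n : ℕ, 1 ≤ n → n ≤ L → q ^ n ≠ 1) {M : ℕ} (hM : M ≤ L) :
    ∑ j ∈ Finset.range (M + 1), ∑ i ∈ Finset.range (M + 1 - j), doubleTerm q M i j =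
      ∑ l ∈ Finset.range (M + 1), q ^ T l := by
  induction M with
  | zero => simp [doubleTerm, T, qPoch_zero]
  | succ M ih =>
    have h1 := qPoch_ne_zero hq hM
    rw [Finset.sum_range_succ, Finset.sum_congr rfl fun j hj => sum_doubleTerm_succ hq hM
      (by rw [Finset.mem_range] at hj; omega)]
    simp only [Finset.sum_add_distrib]
    rw [sum_antisymmTerm, ih (by omega), Finset.sum_range_succ _ (M + 1)]
    simp [doubleTerm, qPoch_zero, h1, T]

lemma qbinom_natCast_sub (q : K) {n k : ℕ} (i : ℕ) (h : k ≤ n) :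
    qbinom q ((n : ℤ) - k) i = gaussBinom q (n - k) i := by
  rw [← Nat.cast_sub h, qbinom, gaussBinom]
  by_cases hi : i ≤ n - k
  · rw [if_pos ⟨by omega, by exact_mod_cast hi⟩, if_pos hi, ← Nat.cast_sub hi]
    simp only [Int.toNat_natCast]
  · rw [if_neg (by omega), if_neg hi]

lemma sum_qbinom_eq_altSum (q : K) {i j : ℕ} (hi : i ≤ L) (hj : j ≤ L) :
    ∑ k ∈ Finset.range (L + 1), q ^ (T i + T j + T k) * (-1 : K) ^ k *
        qbinom q ((L : ℤ) - i) j * qbinom q ((L : ℤ) - j) k * qbinom q ((L : ℤ) - k) i =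
      q ^ (T i + T j) * gaussBinom q (L - i) j * altSum q (L - j) L i := by
  rw [altSum, Finset.mul_sum]
  symm
  refine Finset.sum_subset_zero_on_sdiff
    (Finset.range_mono (show L - j + 1 ≤ L + 1 by omega)) ?_ ?_
  · intro k hk
    simp only [Finset.mem_sdiff, Finset.mem_range] at hk
    rw [qbinom_natCast_sub q k hj, gaussBinom_of_lt q (by omega)]
    simp
  · intro k hk
    rw [Finset.mem_range] at hk
    rw [qbinom_natCast_sub q k hj, qbinom_natCast_sub q j hi,
      qbinom_natCast_sub q i (show k ≤ L by omega)]
    ring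

lemma sum_qbinom_eq_doubleTerm (hq : ∀ n : ℕ, 1 ≤ n → n ≤ L → q ^ n ≠ 1) {i j : ℕ}
    (hij : i + j ≤ L) :
    ∑ k ∈ Finset.range (L + 1), q ^ (T i + T j + T k) * (-1 : K) ^ k *
        qbinom q ((L : ℤ) - i) j * qbinom q ((L : ℤ) - j) k * qbinom q ((L : ℤ) - k) i =
      doubleTerm q L i j := by
  rw [sum_qbinom_eq_altSum q (by omega) (by omega),
    altSum_eq hq le_rfl (by omega) (by omega), gaussBinom, if_pos (by omega), doubleTerm]
  field_simp

end

/-- Polynomial Gauss identity. -/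
theorem stmt5 {K : Type*} [Field K] (L : ℕ) (q : K)
    (hq : ∀ n : ℕ, 1 ≤ n → n ≤ L → q ^ n ≠ 1) :
    ∑ l ∈ Finset.range (L + 1), q ^ T l
      = ∑ i ∈ Finset.range (L + 1), ∑ j ∈ Finset.range (L + 1),
          ∑ k ∈ Finset.range (L + 1),
            q ^ (T i + T j + T k) * (-1 : K) ^ k *
              qbinom q ((L : ℤ) - i) j * qbinom q ((L : ℤ) - j) k *
              qbinom q ((L : ℤ) - k) i := by
  rw [← sum_sum_doubleTerm hq le_rfl, Finset.sum_comm]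
  refine Finset.sum_congr rfl fun j hj => ?_
  rw [Finset.mem_range] at hj
  refine Finset.sum_subset_zero_on_sdiff
    (Finset.range_mono (show L + 1 - j ≤ L + 1 by omega)) ?_ ?_
  · intro i hi
    simp only [Finset.mem_sdiff, Finset.mem_range] at hi
    rw [sum_qbinom_eq_altSum q (by omega) (by omega), gaussBinom_of_lt q (by omega)]
    simp
  · intro i hi
    rw [Finset.mem_range] at hi
    exact (sum_qbinom_eq_doubleTerm hq (by omega)).symm
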